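/- arXiv:2310.12275 — 2 statements merged into one kernel-verified Lean document; each statement's English description precedes it below -/
import Mathlib

section
/- Let t be real with 0 < t < 1, let c ∈ ℂ, let h be a nonnegative integer, and let R be a real number with t^{−h} < R < t^{−h−1}. Then (1/2πi) ∮_{|w|=R} e^{cw}/(−w;t)_∞ dw = (1/(t;t)_∞) Σ_{m=0}^{h} e^{−c t^{−m}} (−1)^m t^{m(m−1)/2}/(t;t)_m, where (1/2πi)∮_{|w|=R} g(w)dw = (1/2π)∫_{0}^{2π} g(R e^{iθ}) R e^{iθ} dθ. -/
open scoped BigOperators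

/-- `(t;t)_n = ∏_{r=1}^{n} (1 - t^r)`. -/
noncomputable def tPochN (t : ℝ) (n : ℕ) : ℝ := ∏ r ∈ Finset.range n, (1 - t ^ (r + 1))

/-- `(t;t)_∞ = ∏_{r=1}^{∞} (1 - t^r)`. -/
noncomputable def tPochInf (t : ℝ) : ℝ := ∏' r : ℕ, (1 - t ^ (r + 1))

/-- The integrand `g(w) = e^{cw} / (-w;t)_∞`, where
`(-w;t)_∞ = ∏_{i≥0} (1 - (-w) t^i) = ∏_{i≥0} (1 + w t^i)`. -/
noncomputable def gInt (t : ℝ) (c : ℂ) (w : ℂ) : ℂ :=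
  Complex.exp (c * w) / ∏' i : ℕ, (1 + w * (t : ℂ) ^ i)

lemma aux_summ (t : ℝ) (ht0 : 0 < t) (ht1 : t < 1) (k : ℕ) (w : ℂ) :
    Summable (fun i : ℕ => ‖w * (t : ℂ) ^ (i + k)‖) := by
  have : (fun i : ℕ => ‖w * (t : ℂ) ^ (i + k)‖) = fun i => (‖w‖ * t ^ k) * t ^ i := by
    funext i
    rw [norm_mul, norm_pow, Complex.norm_real, Real.norm_of_nonneg ht0.le, pow_add]; ring
  rw [this]
  exact (summable_geometric_of_lt_one ht0.le ht1).mul_left _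

lemma aux_mult (t : ℝ) (ht0 : 0 < t) (ht1 : t < 1) (k : ℕ) (w : ℂ) :
    Multipliable (fun i : ℕ => 1 + w * (t : ℂ) ^ (i + k)) :=
  multipliable_one_add_of_summable (aux_summ t ht0 ht1 k w)

lemma aux_diff (t : ℝ) (ht0 : 0 < t) (ht1 : t < 1) (k : ℕ) :
    Differentiable ℂ (fun w : ℂ => ∏' i : ℕ, (1 + w * (t : ℂ) ^ (i + k))) := by
  intro w
  have hb : w ∈ Metric.ball (0 : ℂ) (‖w‖ + 1) := by simp
  have hs : Summable (fun i : ℕ => (‖w‖ + 1) * t ^ (i + k)) :=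
    ((summable_nat_add_iff k).mpr (summable_geometric_of_lt_one ht0.le ht1)).mul_left _
  have H : HasProdLocallyUniformlyOn (fun (i : ℕ) (w : ℂ) => 1 + w * (t : ℂ) ^ (i + k))
      (fun w => ∏' i : ℕ, (1 + w * (t : ℂ) ^ (i + k))) (Metric.ball (0 : ℂ) (‖w‖ + 1)) := by
    refine hs.hasProdLocallyUniformlyOn_nat_one_add
      (f := fun (i : ℕ) (w : ℂ) => w * (t : ℂ) ^ (i + k)) Metric.isOpen_ball
      (.of_forall fun n x hx ↦ ?_) (fun _ ↦ by fun_prop)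
    rw [norm_mul, norm_pow, Complex.norm_real, Real.norm_of_nonneg ht0.le]
    have : ‖x‖ < ‖w‖ + 1 := by simpa using hx
    gcongr
  exact (H.differentiableOn (.of_forall fun _ ↦ by
    simpa [Finset.prod_fn] using DifferentiableOn.finsetProd (fun _ _ ↦ by fun_prop))
      Metric.isOpen_ball).differentiableAt (Metric.isOpen_ball.mem_nhds hb)

lemma aux_K (t : ℂ) (ht : t ≠ 0) (m : ℕ) :
    (∏ j ∈ Finset.range m, (1 + -(t ^ m)⁻¹ * t ^ j)) * (t ^ m * t ^ (m * (m - 1) / 2)) =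
      (-1) ^ m * ∏ r ∈ Finset.range m, (1 - t ^ (r + 1)) := by
  have h1 : ∏ j ∈ Finset.range m, (1 + -(t ^ m)⁻¹ * t ^ j) =
      ∏ j ∈ Finset.range m, (1 - (t ^ (j + 1))⁻¹) := by
    rw [← Finset.prod_range_reflect]
    refine Finset.prod_congr rfl fun j hj => ?_
    have hj := Finset.mem_range.mp hj
    have : t ^ m = t ^ (m - 1 - j) * t ^ (j + 1) := by rw [← pow_add]; congr 1; omega
    rw [this]
    field_simp
    ring
  have h2 : t ^ m * t ^ (m * (m - 1) / 2) = ∏ j ∈ Finset.range m, t ^ (j + 1) := by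
    rw [Finset.prod_pow_eq_pow_sum, ← pow_add, Finset.sum_add_distrib, Finset.sum_range_id]
    simp [add_comm]
  rw [h1, h2, ← Finset.prod_mul_distrib]
  have : (-1 : ℂ) ^ m = ∏ r ∈ Finset.range m, (-1) := by simp
  rw [this, ← Finset.prod_mul_distrib]
  refine Finset.prod_congr rfl fun j _ => ?_
  field_simp
  ring

lemma aux_prod (t : ℝ) (ht0 : 0 < t) (ht1 : t < 1) (h m : ℕ) (hm : m ≤ h) :
    (∏ j ∈ (Finset.range (h + 1)).erase m, (1 + -((t : ℂ) ^ m)⁻¹ * (t : ℂ) ^ j)) *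
      ∏' i : ℕ, (1 + -((t : ℂ) ^ m)⁻¹ * (t : ℂ) ^ (i + (h + 1))) =
    (∏ j ∈ Finset.range m, (1 + -((t : ℂ) ^ m)⁻¹ * (t : ℂ) ^ j)) * ((tPochInf t : ℝ) : ℂ) := by
  have ht : (t : ℂ) ≠ 0 := by exact_mod_cast ht0.ne'
  obtain ⟨d, rfl⟩ := Nat.exists_eq_add_of_le hm
  have hmul : Multipliable (fun r : ℕ => (1 - t ^ (r + 1) : ℝ)) := by
    have := multipliable_one_add_of_summable (f := fun r : ℕ => -t ^ (r + 1)) (by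
      simpa [abs_of_pos ht0] using
        (summable_nat_add_iff 1).mpr (summable_geometric_of_lt_one ht0.le ht1))
    simpa [sub_eq_add_neg] using this
  have hmul2 : Multipliable (fun r : ℕ => (1 - t ^ (r + d + 1) : ℝ)) := by
    have := multipliable_one_add_of_summable (f := fun r : ℕ => -t ^ (r + (d + 1))) (by
      simpa [abs_of_pos ht0] using
        (summable_nat_add_iff (d+1)).mpr (summable_geometric_of_lt_one ht0.le ht1))
    simpa [sub_eq_add_neg, add_assoc] using this
  have e1 : ((tPochInf t : ℝ) : ℂ) = (∏ r ∈ Finset.range d, (1 - (t : ℂ) ^ (r + 1))) *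
      ∏' i : ℕ, (1 + -((t : ℂ) ^ m)⁻¹ * (t : ℂ) ^ (i + (m + d + 1))) := by
    rw [tPochInf, ← Multipliable.prod_mul_tprod_nat_mul' (f := fun r : ℕ => (1 - t ^ (r + 1) : ℝ))
      (k := d) hmul2, Complex.ofReal_mul]
    congr 1
    · push_cast; rfl
    · have := hmul2.map_tprod Complex.ofRealHom Complex.continuous_ofReal
      simp only [Complex.ofRealHom_eq_coe] at this
      rw [this]
      refine tprod_congr fun i => ?_
      push_cast
      have : (t : ℂ) ^ (i + (m + d + 1)) = (t : ℂ) ^ m * (t : ℂ) ^ (i + d + 1) := by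
        rw [← pow_add]; congr 1; omega
      rw [this]
      field_simp
      ring
  have e2 : (Finset.range (m + d + 1)).erase m =
      Finset.range m ∪ (Finset.range d).image (fun r => m + (r + 1)) := by
    ext j
    simp only [Finset.mem_erase, Finset.mem_range, Finset.mem_union, Finset.mem_image]
    constructor
    · intro hj
      by_cases hjm : j < m
      · exact Or.inl hjm
      · exact Or.inr ⟨j - m - 1, by omega, by omega⟩
    · rintro (hj | ⟨r, hr, rfl⟩) <;> omega
  rw [e1, e2, Finset.prod_union, Finset.prod_image, mul_assoc]
  · congr 2
    refine Finset.prod_congr rfl fun r _ => ?_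
    rw [pow_add (t : ℂ) m]
    field_simp
    ring
  · intro a _ b _ hab
    simp only at hab
    omega
  · rw [Finset.disjoint_left]
    intro j hj hj2
    simp only [Finset.mem_range, Finset.mem_image] at hj hj2
    obtain ⟨r, _, rfl⟩ := hj2
    omega

lemma aux_cauchy (F : ℂ → ℂ) (R : ℝ) (hR : 0 < R) (n : ℕ) (a : ℕ → ℂ)
    (ha : ∀ i ∈ Finset.range (n + 1), a i ∈ Metric.ball (0 : ℂ) R)
    (hinj : Set.InjOn a (Finset.range (n + 1) : Finset ℕ))
    (hF : DifferentiableOn ℂ F (Metric.closedBall 0 R)) :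
    (∮ z in C(0, R), F z / ∏ i ∈ Finset.range (n + 1), (z - a i)) =
      2 * Real.pi * Complex.I * ∑ m ∈ Finset.range (n + 1),
        F (a m) / ∏ j ∈ (Finset.range (n + 1)).erase m, (a m - a j) := by
  have hne : ∀ z ∈ Metric.sphere (0 : ℂ) R, ∀ i ∈ Finset.range (n + 1), z ≠ a i := by
    intro z hz i hi e
    have h1 := ha i hi
    rw [← e] at h1
    simp at h1 hz
    linarith
  have step : (∮ z in C(0, R), F z / ∏ i ∈ Finset.range (n + 1), (z - a i)) =
      ∮ z in C(0, R), ∑ m ∈ Finset.range (n + 1),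
        Lagrange.nodalWeight (Finset.range (n + 1)) a m * ((z - a m)⁻¹ • F z) := by
    refine circleIntegral.integral_congr hR.le fun z hz => ?_
    have h1 := congrArg (Polynomial.eval z) (Lagrange.sum_basis hinj ⟨0, by simp⟩)
    rw [Polynomial.eval_finsetSum, Polynomial.eval_one] at h1
    rw [Finset.sum_congr rfl (fun i hi => Lagrange.eval_basis_not_at_node hi (hne z hz i hi)),
      ← Finset.mul_sum, Lagrange.eval_nodal] at h1
    have h2 : ∏ i ∈ Finset.range (n + 1), (z - a i) ≠ 0 :=
      left_ne_zero_of_mul_eq_one h1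
    simp only [smul_eq_mul, ← mul_assoc]
    rw [← Finset.sum_mul, eq_inv_of_mul_eq_one_right h1, div_eq_inv_mul]
  rw [step, circleIntegral.integral_fun_sum, Finset.mul_sum]
  · refine Finset.sum_congr rfl fun m hm => ?_
    rw [circleIntegral.integral_const_mul, hF.circleIntegral_sub_inv_smul (ha m hm),
      Lagrange.nodalWeight, Finset.prod_inv_distrib, smul_eq_mul]
    ring
  · intro m hm
    apply ContinuousOn.circleIntegrable hR.le
    refine continuousOn_const.mul (ContinuousOn.smul (ContinuousOn.inv₀
      (continuousOn_id.sub continuousOn_const) ?_)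
      (hF.continuousOn.mono Metric.sphere_subset_closedBall))
    intro z hz
    exact sub_ne_zero.mpr (hne z hz m hm)

theorem stmt4 (t : ℝ) (c : ℂ) (h : ℕ) (R : ℝ) (ht0 : 0 < t) (ht1 : t < 1)
    (hR1 : t ^ (-(h : ℤ)) < R) (hR2 : R < t ^ (-(h : ℤ) - 1)) :
    (2 * (Real.pi : ℂ))⁻¹ *
        ∫ θ in (0 : ℝ)..(2 * Real.pi),
          gInt t c ((R : ℂ) * Complex.exp (θ * Complex.I)) * (R : ℂ) *
            Complex.exp (θ * Complex.I) =
      ((tPochInf t : ℝ) : ℂ)⁻¹ *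
        ∑ m ∈ Finset.range (h + 1),
          Complex.exp (-c * ((t ^ (-(m : ℤ)) : ℝ) : ℂ)) * (-1) ^ m *
            (t : ℂ) ^ (m * (m - 1) / 2) / ((tPochN t m : ℝ) : ℂ) := by
  have ht : (t : ℂ) ≠ 0 := by exact_mod_cast ht0.ne'
  have hR : 0 < R := lt_trans (by positivity) hR1
  have hRt : R * t ^ (h + 1) < 1 := by
    have : t ^ (-(h : ℤ) - 1) = (t ^ (h + 1))⁻¹ := by
      rw [← zpow_natCast, ← zpow_neg]; congr 1; push_cast; ring
    rw [this] at hR2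
    rwa [← lt_inv_mul_iff₀' (by positivity), mul_one]
  have hRh : (t ^ h)⁻¹ < R := by rwa [zpow_neg, zpow_natCast] at hR1
  set Q : ℂ → ℂ := fun w => ∏' i : ℕ, (1 + w * (t : ℂ) ^ (i + (h + 1))) with hQ
  have hQ0 : ∀ w ∈ Metric.closedBall (0 : ℂ) R, Q w ≠ 0 := by
    intro w hw
    refine tprod_one_add_ne_zero_of_summable (f := fun i : ℕ => w * (t : ℂ) ^ (i + (h + 1)))
      (fun i => ?_) (aux_summ t ht0 ht1 _ w)
    intro e
    have e1 : w * (t : ℂ) ^ (i + (h + 1)) = -1 := by linear_combination e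
    have e2 := congrArg norm e1
    rw [norm_mul, norm_pow, Complex.norm_real, Real.norm_of_nonneg ht0.le, norm_neg, norm_one,
      pow_add] at e2
    have hw' : ‖w‖ ≤ R := by simpa using hw
    have h3 : t ^ i ≤ 1 := pow_le_one₀ ht0.le ht1.le
    have h4 : ‖w‖ * (t ^ i * t ^ (h + 1)) ≤ R * (1 * t ^ (h + 1)) := by gcongr
    linarith
  set a : ℕ → ℂ := fun i => -((t : ℂ) ^ i)⁻¹ with ha
  set D : ℂ := ∏ i ∈ Finset.range (h + 1), (t : ℂ) ^ i with hD
  set F : ℂ → ℂ := fun w => Complex.exp (c * w) / (D * Q w) with hF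
  have hD0 : D ≠ 0 := Finset.prod_ne_zero_iff.mpr fun i _ => pow_ne_zero _ ht
  have hfac : ∀ (w : ℂ) (i : ℕ), 1 + w * (t : ℂ) ^ i = (t : ℂ) ^ i * (w - a i) := by
    intro w i
    simp only [ha]
    field_simp
    ring
  have hg : ∀ w, gInt t c w = F w / ∏ i ∈ Finset.range (h + 1), (w - a i) := by
    intro w
    have : ∏' i : ℕ, (1 + w * (t : ℂ) ^ i) =
        (D * ∏ i ∈ Finset.range (h + 1), (w - a i)) * Q w := by
      rw [← Multipliable.prod_mul_tprod_nat_mul' (f := fun i : ℕ => 1 + w * (t : ℂ) ^ i)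
        (k := h + 1) (aux_mult t ht0 ht1 _ w), hD, ← Finset.prod_mul_distrib]
      simp only [hfac, hQ]
    rw [gInt, this, hF, div_div]
    congr 1
    ring
  have hFd : DifferentiableOn ℂ F (Metric.closedBall 0 R) := by
    refine DifferentiableOn.div (by fun_prop)
      ((differentiableOn_const D).mul (aux_diff t ht0 ht1 (h + 1)).differentiableOn) ?_
    intro w hw
    exact mul_ne_zero hD0 (hQ0 w hw)
  have hab : ∀ i ∈ Finset.range (h + 1), a i ∈ Metric.ball (0 : ℂ) R := by
    intro i hi
    have hi : i ≤ h := by have := Finset.mem_range.mp hi; omega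
    rw [mem_ball_zero_iff, ha, norm_neg, norm_inv, norm_pow, Complex.norm_real,
      Real.norm_of_nonneg ht0.le]
    refine lt_of_le_of_lt ?_ hRh
    exact inv_anti₀ (by positivity) (pow_le_pow_of_le_one ht0.le ht1.le hi)
  have hinj : Set.InjOn a (Finset.range (h + 1) : Finset ℕ) := by
    intro i _ j _ hij
    simp only [ha, neg_inj, inv_inj] at hij
    exact (pow_right_strictAnti₀ ht0 ht1).injective (by exact_mod_cast hij)
  have main := aux_cauchy F R hR h a hab hinj hFd
  have hint : (∮ z in C(0, R), F z / ∏ i ∈ Finset.range (h + 1), (z - a i)) =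
      Complex.I * ∫ θ in (0 : ℝ)..(2 * Real.pi),
          gInt t c ((R : ℂ) * Complex.exp (θ * Complex.I)) * (R : ℂ) *
            Complex.exp (θ * Complex.I) := by
    rw [circleIntegral, ← intervalIntegral.integral_const_mul]
    refine intervalIntegral.integral_congr fun θ _ => ?_
    simp only [deriv_circleMap, circleMap, zero_add, smul_eq_mul, ← hg]
    ring
  rw [hint] at main
  have hpi : (Real.pi : ℂ) ≠ 0 := by exact_mod_cast Real.pi_ne_zero
  have main2 : (∫ θ in (0 : ℝ)..(2 * Real.pi),
          gInt t c ((R : ℂ) * Complex.exp (θ * Complex.I)) * (R : ℂ) *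
            Complex.exp (θ * Complex.I)) = 2 * Real.pi * ∑ m ∈ Finset.range (h + 1),
        F (a m) / ∏ j ∈ (Finset.range (h + 1)).erase m, (a m - a j) := by
    apply mul_left_cancel₀ Complex.I_ne_zero
    rw [main]; ring
  rw [main2, inv_mul_cancel_left₀ (by simpa using hpi), Finset.mul_sum]
  refine Finset.sum_congr rfl fun m hm => ?_
  have hmh : m ≤ h := by have := Finset.mem_range.mp hm; omega
  have hP := aux_prod t ht0 ht1 h m hmh
  have hK := aux_K (t : ℂ) ht m
  have hN : ((tPochN t m : ℝ) : ℂ) = ∏ r ∈ Finset.range m, (1 - (t : ℂ) ^ (r + 1)) := by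
    rw [tPochN]; push_cast; rfl
  rw [← hN] at hK
  have hE : D * ∏ j ∈ (Finset.range (h + 1)).erase m, (a m - a j) =
      (t : ℂ) ^ m * ∏ j ∈ (Finset.range (h + 1)).erase m, (1 + a m * (t : ℂ) ^ j) := by
    simp only [hfac]
    rw [Finset.prod_mul_distrib, hD, ← Finset.mul_prod_erase _ _ hm]
    ring
  have hQm := hQ0 (a m) (Metric.ball_subset_closedBall (hab m hm))
  have hE0 : ∏ j ∈ (Finset.range (h + 1)).erase m, (a m - a j) ≠ 0 := by
    refine Finset.prod_ne_zero_iff.mpr fun j hj => sub_ne_zero.mpr fun e => ?_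
    have hj' := Finset.mem_erase.mp hj
    exact hj'.1 (hinj hm hj'.2 e).symm
  set E := ∏ j ∈ (Finset.range (h + 1)).erase m, (a m - a j)
  set G := ∏ j ∈ (Finset.range (h + 1)).erase m, (1 + a m * (t : ℂ) ^ j)
  set L := ∏ j ∈ Finset.range m, (1 + -((t : ℂ) ^ m)⁻¹ * (t : ℂ) ^ j)
  have hP' : G * Q (a m) = L * ((tPochInf t : ℝ) : ℂ) := hP
  have hG0 : G ≠ 0 := fun e => mul_ne_zero hD0 hE0 (by rw [hE, e, mul_zero])
  have hLT : L * ((tPochInf t : ℝ) : ℂ) ≠ 0 := hP' ▸ mul_ne_zero hG0 hQm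
  have hL0 := left_ne_zero_of_mul hLT
  have hT0 := right_ne_zero_of_mul hLT
  have hN0 : ((tPochN t m : ℝ) : ℂ) ≠ 0 := by
    intro e
    rw [e, mul_zero] at hK
    exact mul_ne_zero hL0 (mul_ne_zero (pow_ne_zero _ ht) (pow_ne_zero _ ht)) hK
  have hexp : Complex.exp (-c * ((t ^ (-(m : ℤ)) : ℝ) : ℂ)) = Complex.exp (c * a m) := by
    congr 1
    simp [ha]
  rw [hexp]
  simp only [hF]
  have hden : D * Q (a m) * E = (t : ℂ) ^ m * (L * ((tPochInf t : ℝ) : ℂ)) := by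
    rw [← hP']; linear_combination Q (a m) * hE
  have hsq : ((-1 : ℂ) ^ m) * (-1) ^ m = 1 := by rw [← mul_pow]; simp
  rw [div_div, hden, inv_mul_eq_div, div_div,
    div_eq_div_iff (mul_ne_zero (pow_ne_zero _ ht) hLT) (mul_ne_zero hN0 hT0)]
  linear_combination (-Complex.exp (c * a m) * (-1) ^ m * ((tPochInf t : ℝ) : ℂ)) * hK
    - (Complex.exp (c * a m) * ((tPochInf t : ℝ) : ℂ) * ((tPochN t m : ℝ) : ℂ)) * hsq
end

section
/- For every real t with 0 < t < 1, every real χ > 0 and every integer L, the series Σ_{x=0}^{∞} F_{t,χ}(L − x, x) converges and equals p_{t,χ}(L). (This is the consistency of the two-dimensional law: summing the weight of the pair (L, L−x) over x ≥ 0 recovers the one-dimensional weight at L.) -/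
open scoped BigOperators

/-- The `t`-binomial coefficient `[n choose c]_t` for natural `c ≤ n`, `0` otherwise. -/
noncomputable def tBinomN (t : ℝ) (n c : ℕ) : ℝ :=
  if c ≤ n then tPochN t n / (tPochN t c * tPochN t (n - c)) else 0

/-- The `m`-th term of the series defining `F_{t,χ}(L,x)`. -/
noncomputable def Fterm (t χ : ℝ) (L : ℤ) (x m : ℕ) : ℝ :=
  Real.exp (-χ * t ^ (L - (m : ℤ))) * (-1) ^ m *
    t ^ ((m : ℤ) ^ 2 + ((x : ℤ) - 1) * (m : ℤ) + (x : ℤ) * ((x : ℤ) - 1) / 2) *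
    ∑ i ∈ Finset.range (x + 1),
      ((-1) ^ (x - i) / tPochN t (x - i)) * tBinomN t (m + i) i *
        ((t ^ (L - (m : ℤ)) * χ) ^ (i + m) / ((i + m).factorial : ℝ) +
          if 1 ≤ i + m then (t ^ (L - (m : ℤ)) * χ) ^ (i + m - 1) / (((i + m - 1).factorial : ℝ))
          else 0)

/-- `F_{t,χ}(L,x) = Pr(𝓛_{2,t,χ} = (L+x,L))`. -/
noncomputable def Fweight (t χ : ℝ) (L : ℤ) (x : ℕ) : ℝ :=
  (tPochInf t)⁻¹ * ∑' m : ℕ, Fterm t χ L x m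

/-- The `m`-th term of the series defining the weight of `𝓛^{(1)}_{t,χ}` at `y`. -/
noncomputable def lterm (t χ : ℝ) (y : ℤ) (m : ℕ) : ℝ :=
  Real.exp (-χ * t ^ (y - (m : ℤ))) * (-1) ^ m * t ^ (m * (m - 1) / 2) / tPochN t m

/-- `p_{t,χ}(y) = (1/(t;t)_∞) Σ_{m≥0} e^{-χ t^{y-m}} (-1)^m t^{m(m-1)/2}/(t;t)_m`. -/
noncomputable def pWeight (t χ : ℝ) (y : ℤ) : ℝ :=
  (tPochInf t)⁻¹ * ∑' m : ℕ, lterm t χ y m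

lemma aux_P_pos (t : ℝ) (ht0 : 0 < t) (ht1 : t < 1) (n : ℕ) : 0 < tPochN t n := by
  unfold tPochN
  refine Finset.prod_pos fun r _ => ?_
  have := pow_lt_one₀ ht0.le ht1 (Nat.succ_ne_zero r)
  simp only [Nat.succ_eq_add_one] at this
  linarith

lemma aux_P_succ (t : ℝ) (n : ℕ) : tPochN t (n + 1) = tPochN t n * (1 - t ^ (n + 1)) := by
  unfold tPochN
  rw [Finset.prod_range_succ]

lemma aux_P_zero (t : ℝ) : tPochN t 0 = 1 := by
  simp [tPochN]

lemma aux_P_le_one (t : ℝ) (ht0 : 0 < t) (ht1 : t < 1) (n : ℕ) : tPochN t n ≤ 1 := by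
  induction n with
  | zero => simp [tPochN]
  | succ n ih =>
    rw [aux_P_succ]
    have h1 := aux_P_pos t ht0 ht1 n
    have h2 : 0 < t ^ (n + 1) := by positivity
    nlinarith

lemma aux_P_inv (t : ℝ) (ht0 : 0 < t) (ht1 : t < 1) :
    ∃ C : ℝ, 1 ≤ C ∧ ∀ n, (tPochN t n)⁻¹ ≤ C := by
  have key : ∀ n, (tPochN t n)⁻¹ ≤
      Real.exp ((1 - t)⁻¹ * ∑ r ∈ Finset.range n, t ^ r) := by
    intro n
    induction n with
    | zero => simp [tPochN]
    | succ n ih =>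
      rw [aux_P_succ, Finset.sum_range_succ, mul_add, Real.exp_add, mul_inv]
      have hp : t ^ (n + 1) ≤ t := by
        have := pow_le_pow_of_le_one ht0.le ht1.le (show 1 ≤ n + 1 by omega)
        simpa using this
      have hp2 : t ^ (n + 1) ≤ t ^ n := pow_le_pow_of_le_one ht0.le ht1.le (by omega)
      have h1 : 0 < 1 - t ^ (n + 1) := by linarith
      have h0 : 0 < 1 - t := by linarith
      have : (1 - t ^ (n + 1))⁻¹ ≤ Real.exp ((1 - t)⁻¹ * t ^ n) := by
        refine le_trans ?_ (Real.add_one_le_exp _)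
        have e : (1 - t ^ (n + 1))⁻¹ = (1 - t ^ (n + 1))⁻¹ * t ^ (n + 1) + 1 := by
          field_simp; ring
        rw [e]
        gcongr
      have hP := aux_P_pos t ht0 ht1 n
      gcongr
  refine ⟨Real.exp ((1 - t)⁻¹ * (1 - t)⁻¹), ?_, fun n => (key n).trans ?_⟩
  · have h0 : 0 < 1 - t := by linarith
    exact Real.one_le_exp (by positivity)
  · have h0 : 0 < 1 - t := by linarith
    gcongr
    rw [← tsum_geometric_of_lt_one ht0.le ht1]
    exact (summable_geometric_of_lt_one ht0.le ht1).sum_le_tsum _ (fun i _ => by positivity)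

lemma aux_choose_int (x : ℕ) : (x : ℤ) * ((x : ℤ) - 1) / 2 = ((x.choose 2 : ℕ) : ℤ) := by
  rw [Nat.choose_two_right]
  cases x with
  | zero => simp
  | succ n => push_cast; simp

lemma aux_choose_add (x m : ℕ) :
    (m : ℤ) ^ 2 + ((x : ℤ) - 1) * (m : ℤ) + ((x.choose 2 : ℕ) : ℤ) =
      (((x + m).choose 2 + m.choose 2 : ℕ) : ℤ) := by
  have h : ∀ y : ℕ, 2 * ((y.choose 2 : ℕ) : ℤ) = y * ((y : ℤ) - 1) := by
    intro y
    induction y with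
    | zero => simp
    | succ n ih =>
      rw [Nat.choose_succ_succ' n 1]
      push_cast
      rw [mul_add, ih]
      simp; ring
  have h1 := h x
  have h2 := h m
  have h3 := h (x + m)
  push_cast at *
  linarith

noncomputable def auxg (z : ℝ) (k : ℕ) : ℝ :=
  z ^ k / (k.factorial : ℝ) + if 1 ≤ k then z ^ (k - 1) / ((k - 1).factorial : ℝ) else 0

lemma aux_Fterm (t χ : ℝ) (ht0 : 0 < t) (L : ℤ) (x m : ℕ) :
    Fterm t χ (L - (x : ℤ)) x m =
      Real.exp (-(t ^ (L - ((x + m : ℕ) : ℤ)) * χ)) * (-1) ^ m *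
        t ^ ((x + m).choose 2 + m.choose 2) *
      ∑ i ∈ Finset.range (x + 1),
      ((-1) ^ (x - i) / tPochN t (x - i)) * tBinomN t (m + i) i *
        auxg (t ^ (L - ((x + m : ℕ) : ℤ)) * χ) (i + m) := by
  unfold Fterm auxg
  rw [aux_choose_int, aux_choose_add, zpow_natCast]
  have : L - (x : ℤ) - (m : ℤ) = L - ((x + m : ℕ) : ℤ) := by push_cast; ring
  rw [this]
  have e2 : -χ * t ^ (L - ((x + m : ℕ) : ℤ)) = -(t ^ (L - ((x + m : ℕ) : ℤ)) * χ) := by ring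
  rw [e2]

lemma aux_binom_partial (t : ℝ) (ht0 : 0 < t) (ht1 : t < 1) (K M : ℕ) (hM : M ≤ K) :
    ∑ m ∈ Finset.range (M + 1), (-1 : ℝ) ^ m * t ^ (m.choose 2) *
      (tPochN t (K + 1) / (tPochN t m * tPochN t (K + 1 - m))) =
    (-1) ^ M * t ^ ((M + 1).choose 2) * (tPochN t K / (tPochN t M * tPochN t (K - M))) := by
  have hne : ∀ n, tPochN t n ≠ 0 := fun n => (aux_P_pos t ht0 ht1 n).ne'
  have hne1 : ∀ n, 1 - t ^ (n + 1) ≠ 0 := fun n h => by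
    have := hne (n + 1); rw [aux_P_succ, h] at this; simp at this
  induction M with
  | zero =>
    simp [aux_P_zero, hne]
  | succ M ih =>
    rw [Finset.sum_range_succ, ih (by omega)]
    obtain ⟨d, rfl⟩ : ∃ d, K = M + 1 + d := ⟨K - (M + 1), by omega⟩
    have e1 : M + 1 + d - M = d + 1 := by omega
    have e2 : M + 1 + d + 1 - (M + 1) = d + 1 := by omega
    have e3 : M + 1 + d - (M + 1) = d := by omega
    have e4 : (M + 1 + 1).choose 2 = (M + 1).choose 2 + (M + 1) := by
      rw [Nat.choose_succ_succ' (M + 1) 1]; simp; ring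
    rw [e1, e2, e3, e4, aux_P_succ t (M + 1 + d), aux_P_succ t d, aux_P_succ t M]
    have := hne M
    have := hne d
    have := hne1 M
    have := hne1 d
    field_simp
    ring

lemma aux_binom (t : ℝ) (ht0 : 0 < t) (ht1 : t < 1) (k : ℕ) (hk : k ≠ 0) :
    ∑ m ∈ Finset.range (k + 1), (-1 : ℝ) ^ m * t ^ (m.choose 2) *
      (tPochN t k / (tPochN t m * tPochN t (k - m))) = 0 := by
  obtain ⟨K, rfl⟩ := Nat.exists_eq_succ_of_ne_zero hk
  have hne : ∀ n, tPochN t n ≠ 0 := fun n => (aux_P_pos t ht0 ht1 n).ne'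
  rw [Finset.sum_range_succ, Nat.succ_eq_add_one, aux_binom_partial t ht0 ht1 K K le_rfl]
  have := hne K
  have := hne (K + 1)
  simp only [Nat.sub_self, aux_P_zero]
  field_simp
  ring

lemma aux_diag (t χ : ℝ) (ht0 : 0 < t) (ht1 : t < 1) (L : ℤ) (n : ℕ) :
    ∑ p ∈ Finset.HasAntidiagonal.antidiagonal n, Fterm t χ (L - (p.1 : ℤ)) p.1 p.2 = lterm t χ L n := by
  have hne : ∀ n, tPochN t n ≠ 0 := fun n => (aux_P_pos t ht0 ht1 n).ne'
  rw [← Finset.Nat.sum_antidiagonal_swap, Finset.Nat.sum_antidiagonal_eq_sum_range_succ_mk]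
  simp only [Prod.fst_swap, Prod.snd_swap]
  set z := t ^ (L - (n : ℤ)) * χ with hz
  set f : ℕ → ℕ → ℝ := fun m i => (-1 : ℝ) ^ m * t ^ (m.choose 2) *
    (tPochN t (m + i) / (tPochN t m * tPochN t i)) *
    (((-1) ^ (n - (m + i)) / tPochN t (n - (m + i))) * auxg z (m + i)) with hf
  have h1 : ∀ m ∈ Finset.range (n + 1), Fterm t χ (L - ((n - m : ℕ) : ℤ)) (n - m) m =
      Real.exp (-z) * t ^ (n.choose 2) * ∑ i ∈ Finset.range (n + 1 - m), f m i := by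
    intro m hm
    have hm' : m ≤ n := by simpa [Nat.lt_succ_iff] using hm
    rw [aux_Fterm t χ ht0, Nat.sub_add_cancel hm', ← hz, pow_add,
      show n - m + 1 = n + 1 - m by omega, Finset.mul_sum, Finset.mul_sum]
    refine Finset.sum_congr rfl fun i hi => ?_
    simp only [hf, tBinomN]
    rw [if_pos (by omega), show m + i - i = m by omega, show n - m - i = n - (m + i) by omega,
      add_comm i m, mul_comm (tPochN t i)]
    ring
  rw [Finset.sum_congr rfl h1, ← Finset.mul_sum, ← Finset.sum_range_diag_flip]
  have h2 : ∀ k ∈ Finset.range (n + 1), ∑ m ∈ Finset.range (k + 1), f m (k - m) =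
      if k = 0 then (-1) ^ n / tPochN t n else 0 := by
    intro k _
    have : ∑ m ∈ Finset.range (k + 1), f m (k - m) =
      (∑ m ∈ Finset.range (k + 1), (-1 : ℝ) ^ m * t ^ (m.choose 2) *
      (tPochN t k / (tPochN t m * tPochN t (k - m)))) *
      (((-1) ^ (n - k) / tPochN t (n - k)) * auxg z k) := by
      rw [Finset.sum_mul]
      refine Finset.sum_congr rfl fun m hm => ?_
      have hm' : m ≤ k := by simpa [Nat.lt_succ_iff] using hm
      simp only [hf]
      rw [Nat.add_sub_cancel' hm']
    rw [this]
    split_ifs with hk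
    · subst hk
      simp [aux_P_zero, auxg]
    · rw [aux_binom t ht0 ht1 k hk, zero_mul]
  rw [Finset.sum_congr rfl h2]
  simp only [Finset.sum_ite_eq', Finset.mem_range, Nat.succ_pos, if_true]
  unfold lterm
  rw [← Nat.choose_two_right, show -χ * t ^ (L - (n : ℤ)) = -z by rw [hz]; ring]
  ring

lemma aux_sum_g (z : ℝ) (hz : 0 ≤ z) (x m : ℕ) :
    ∑ i ∈ Finset.range (x + 1), auxg z (i + m) ≤ 2 * Real.exp z := by
  have hs := Real.summable_pow_div_factorial z
  have he : Real.exp z = ∑' n : ℕ, z ^ n / (n.factorial : ℝ) := by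
    rw [Real.exp_eq_exp_ℝ, NormedSpace.exp_eq_tsum_div]
  have hb : ∀ N, ∑ n ∈ Finset.range N, z ^ n / (n.factorial : ℝ) ≤ Real.exp z := by
    intro N
    rw [he]
    exact hs.sum_le_tsum _ (fun i _ => by positivity)
  have hg : ∀ k, 0 ≤ auxg z k := by
    intro k; unfold auxg; split_ifs <;> positivity
  have h1 : ∑ i ∈ Finset.range (x + 1), auxg z (i + m) ≤
      ∑ k ∈ Finset.range (m + (x + 1)), auxg z k := by
    rw [Finset.sum_range_add (fun k => auxg z k) m (x + 1)]
    simp only [add_comm _ m]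
    have := Finset.sum_nonneg (fun i (_ : i ∈ Finset.range m) => hg i)
    linarith
  refine h1.trans ?_
  rw [show m + (x + 1) = (m + x) + 1 by ring]
  unfold auxg
  rw [Finset.sum_add_distrib, Finset.sum_range_succ' (fun k => if 1 ≤ k then _ else _)]
  simp
  have a := hb (m + x + 1)
  have b := hb (m + x)
  linarith

lemma aux_summable (t χ : ℝ) (ht0 : 0 < t) (ht1 : t < 1) (hχ : 0 < χ) (L : ℤ) :
    Summable fun p : ℕ × ℕ => Fterm t χ (L - (p.1 : ℤ)) p.1 p.2 := by
  obtain ⟨C, hC1, hC⟩ := aux_P_inv t ht0 ht1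
  have hs : Summable fun n : ℕ => t ^ (n.choose 2) := by
    rw [← summable_nat_add_iff 1]
    refine Summable.of_nonneg_of_le (fun n => by positivity) (fun n => ?_)
      (summable_geometric_of_lt_one ht0.le ht1)
    refine pow_le_pow_of_le_one ht0.le ht1.le ?_
    rw [Nat.choose_succ_succ' n 1]; simp
  have hs2 := (hs.mul_of_nonneg hs (fun n => by positivity) (fun n => by positivity)).mul_left
    (C ^ 3 * 2)
  refine Summable.of_norm_bounded hs2 ?_
  rintro ⟨x, m⟩
  simp only
  rw [aux_Fterm t χ ht0]
  set z := t ^ (L - ((x + m : ℕ) : ℤ)) * χ with hz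
  have hz0 : 0 ≤ z := by positivity
  have hg : ∀ k, 0 ≤ auxg z k := by
    intro k; unfold auxg; split_ifs <;> positivity
  have hS : |∑ i ∈ Finset.range (x + 1),
      ((-1) ^ (x - i) / tPochN t (x - i)) * tBinomN t (m + i) i * auxg z (i + m)| ≤
      C ^ 3 * (2 * Real.exp z) := by
    refine (Finset.abs_sum_le_sum_abs _ _).trans ?_
    refine le_trans ?_ (mul_le_mul_of_nonneg_left (aux_sum_g z hz0 x m) (by positivity))
    rw [Finset.mul_sum]
    refine Finset.sum_le_sum fun i _ => ?_
    rw [abs_mul, abs_of_nonneg (hg _)]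
    refine mul_le_mul_of_nonneg_right ?_ (hg _)
    unfold tBinomN
    rw [if_pos (by omega), abs_mul, abs_div, abs_pow, abs_neg, abs_one, one_pow,
      abs_of_pos (aux_P_pos t ht0 ht1 _), abs_of_pos (div_pos (aux_P_pos t ht0 ht1 _)
        (mul_pos (aux_P_pos t ht0 ht1 _) (aux_P_pos t ht0 ht1 _))), one_div, div_eq_mul_inv,
        mul_inv]
    have p := fun n => aux_P_pos t ht0 ht1 n
    have pi := fun n => inv_pos.2 (p n)
    calc _ ≤ C * (1 * (C * C)) := by
          gcongr
          · exact mul_nonneg (p _).le (mul_pos (pi _) (pi _)).le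
          · exact hC _
          · exact (mul_pos (pi _) (pi _)).le
          · exact aux_P_le_one t ht0 ht1 _
          · exact (pi _).le
          · exact hC _
          · exact hC _
      _ = C ^ 3 := by ring
  rw [Real.norm_eq_abs, abs_mul, abs_mul, abs_mul, abs_pow, abs_neg, abs_one, one_pow, mul_one,
    abs_of_pos (Real.exp_pos _), abs_of_pos (pow_pos ht0 _)]
  have hT : t ^ ((x + m).choose 2 + m.choose 2) ≤ t ^ (x.choose 2) * t ^ (m.choose 2) := by
    rw [← pow_add]
    refine pow_le_pow_of_le_one ht0.le ht1.le ?_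
    have := Nat.choose_le_choose 2 (show x ≤ x + m by omega)
    omega
  calc _ ≤ Real.exp (-z) * (t ^ (x.choose 2) * t ^ (m.choose 2)) * (C ^ 3 * (2 * Real.exp z)) := by
        gcongr
    _ = (Real.exp (-z) * Real.exp z) * (C ^ 3 * 2 * (t ^ (x.choose 2) * t ^ (m.choose 2))) := by
        ring
    _ = _ := by rw [← Real.exp_add]; simp

theorem stmt18 (t χ : ℝ) (ht0 : 0 < t) (ht1 : t < 1) (hχ : 0 < χ) (L : ℤ) :
    (Summable fun x : ℕ => Fweight t χ (L - (x : ℤ)) x) ∧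
    ∑' x : ℕ, Fweight t χ (L - (x : ℤ)) x = pWeight t χ L := by
  have hs := aux_summable t χ ht0 ht1 hχ L
  refine ⟨hs.prod.mul_left _, ?_⟩
  unfold Fweight pWeight
  rw [tsum_mul_left, ← hs.tsum_prod, ← Finset.HasAntidiagonal.sigmaAntidiagonalEquivProd.tsum_eq]
  congr 1
  have hs' := (Finset.HasAntidiagonal.sigmaAntidiagonalEquivProd (A := ℕ)).summable_iff.2 hs
  refine (Summable.tsum_sigma' (fun n => (hasSum_fintype _).summable) hs').trans ?_
  refine tsum_congr fun n => ?_
  rw [tsum_fintype, ← aux_diag t χ ht0 ht1 L n]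
  exact Finset.sum_coe_sort (Finset.HasAntidiagonal.antidiagonal n)
    (fun p : ℕ × ℕ => Fterm t χ (L - (p.1 : ℤ)) p.1 p.2)
end
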